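/- π·Γ(1/3)²/(6·Γ(5/6)²) = ∑_{n=0}^∞ (−1/27)^n · [(1)_n (1/2)_n (2/3)_n / ((4/3)_n³)] · (3 + 7n). -/

import Mathlib

open Real

/-- Pochhammer symbol (x)_n = x (x+1) ⋯ (x+n-1). -/
noncomputable def poch (x : ℝ) (n : ℕ) : ℝ :=
  ∏ k ∈ Finset.range n, (x + k)

/-- Coefficient not depending on the deformation parameter. -/
noncomputable def accA (n : ℕ) : ℝ :=
  (n.factorial : ℝ) ^ 2 * poch (1/2) n / ((3 * n + 2).factorial : ℝ)

noncomputable def accR (D : ℝ) (n : ℕ) : ℝ :=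
  poch (1 - D) n * poch (2 * D) n / poch (D + 1) n ^ 2

noncomputable def accB (D : ℝ) (n : ℕ) : ℝ :=
  poch (-D) n * poch (2 * D) n / poch (D + 2) n ^ 2

noncomputable def accT (D : ℝ) (n : ℕ) : ℝ :=
  (-1) ^ n * accA n * accR D n * (7 * n ^ 2 + (6 + 5 * D) * n + 1 + 3 * D)

lemma poch_zero' (x : ℝ) : poch x 0 = 1 := by simp [poch]

lemma poch_succ' (x : ℝ) (n : ℕ) : poch x (n + 1) = poch x n * (x + n) := by
  simp [poch, Finset.prod_range_succ]

lemma poch_pos' {x : ℝ} (hx : 0 < x) (n : ℕ) : 0 < poch x n :=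
  Finset.prod_pos fun i _ => by positivity

lemma poch_nonneg' {x : ℝ} (hx : 0 ≤ x) (n : ℕ) : 0 ≤ poch x n :=
  Finset.prod_nonneg fun i _ => by positivity

lemma poch_abs_le {x z : ℝ} (h : |x| ≤ z) (n : ℕ) : |poch x n| ≤ poch z n := by
  unfold poch
  rw [Finset.abs_prod]
  apply Finset.prod_le_prod
  · intro i _; positivity
  · intro i _
    calc |x + i| ≤ |x| + |(i : ℝ)| := abs_add_le _ _
      _ = |x| + i := by rw [Nat.abs_cast]
      _ ≤ z + i := by linarith

lemma poch_two_le {D z : ℝ} (hD : 0 ≤ D) (h : D ≤ z) (n : ℕ) :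
    poch (2 * D) n ≤ 2 ^ n * poch z n := by
  induction n with
  | zero => simp [poch_zero']
  | succ n ih =>
    rw [poch_succ', poch_succ', pow_succ]
    have h1 : 2 * D + n ≤ 2 * (z + n) := by
      have : (0 : ℝ) ≤ n := by positivity
      linarith
    calc poch (2 * D) n * (2 * D + n) ≤ (2 ^ n * poch z n) * (2 * (z + n)) := by
          apply mul_le_mul ih h1 (by positivity)
          have := poch_nonneg' (hD.trans h) n
          positivity
      _ = _ := by ring

lemma poch_ratio_bound {x D z : ℝ} (hD : 0 ≤ D) (hz : 0 < z) (h : D ≤ z) (hx : |x| ≤ z) (n : ℕ) :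
    |poch x n * poch (2 * D) n / poch z n ^ 2| ≤ 2 ^ n := by
  have hp := poch_pos' hz n
  rw [abs_div, abs_mul, abs_of_nonneg (poch_nonneg' (by positivity : 0 ≤ 2 * D) n),
    abs_of_pos (by positivity : 0 < poch z n ^ 2), div_le_iff₀ (by positivity)]
  calc |poch x n| * poch (2 * D) n ≤ poch z n * (2 ^ n * poch z n) :=
        mul_le_mul (poch_abs_le hx n) (poch_two_le hD h n)
          (poch_nonneg' (by positivity) n) hp.le
    _ = _ := by ring

lemma fact_step (n : ℕ) : ((3 * (n + 1) + 2).factorial : ℝ) =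
    (3 * n + 5) * (3 * n + 4) * (3 * n + 3) * ((3 * n + 2).factorial : ℝ) := by
  have : 3 * (n + 1) + 2 = (3 * n + 2) + 1 + 1 + 1 := by ring
  rw [this, Nat.factorial_succ, Nat.factorial_succ, Nat.factorial_succ]
  push_cast; ring

lemma accA_succ (n : ℕ) : accA (n + 1) * (3 * (3 * n + 4) * (3 * n + 5)) =
    accA n * ((n + 1) * (n + 1/2)) := by
  unfold accA
  rw [fact_step, poch_succ', Nat.factorial_succ]
  have : ((3 * n + 2).factorial : ℝ) ≠ 0 := by positivity
  push_cast
  field_simp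
  ring

lemma accA_nonneg (n : ℕ) : 0 ≤ accA n := by
  unfold accA
  have := poch_pos' (by norm_num : (0:ℝ) < 1/2) n
  positivity

lemma accA_le (n : ℕ) : accA n ≤ (1/6) ^ n := by
  induction n with
  | zero => simp [accA, poch_zero']; norm_num [Nat.factorial]
  | succ n ih =>
    have h := accA_succ n
    have h0 := accA_nonneg n
    have hpos : (0:ℝ) < 3 * (3 * n + 4) * (3 * n + 5) := by positivity
    have h2 : accA n * ((n + 1) * (n + 1/2)) ≤ accA n * ((3 * (3 * n + 4) * (3 * n + 5)) / 6) := by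
      apply mul_le_mul_of_nonneg_left _ h0
      have : (0 : ℝ) ≤ n := by positivity
      nlinarith
    have h3 : accA (n + 1) ≤ accA n / 6 := by
      have : accA (n+1) * (3 * (3 * n + 4) * (3 * n + 5)) ≤
          (accA n / 6) * (3 * (3 * n + 4) * (3 * n + 5)) := by
        rw [h]; linarith
      exact le_of_mul_le_mul_right this hpos
    rw [pow_succ]; linarith

lemma accR_bound {D : ℝ} (hD : 0 ≤ D) (n : ℕ) : |accR D n| ≤ 2 ^ n :=
  poch_ratio_bound hD (by linarith) (by linarith) (abs_le.2 ⟨by linarith, by linarith⟩) n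

lemma accB_bound {D : ℝ} (hD : 0 ≤ D) (n : ℕ) : |accB D n| ≤ 2 ^ n :=
  poch_ratio_bound hD (by linarith) (by linarith) (abs_le.2 ⟨by linarith, by linarith⟩) n

lemma accAX_bound {x : ℝ} (n : ℕ) (hx : |x| ≤ 2 ^ n) :
    |(-1) ^ n * accA n * x| ≤ (1/3) ^ n := by
  rw [abs_mul, abs_mul, abs_pow, abs_neg, abs_one, one_pow, one_mul, abs_of_nonneg (accA_nonneg n)]
  calc accA n * |x| ≤ (1/6) ^ n * 2 ^ n := by
        apply mul_le_mul (accA_le n) hx (abs_nonneg _) (by positivity)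
    _ = (1/3) ^ n := by rw [← mul_pow]; norm_num

lemma accT_bound {D : ℝ} (hD : 0 ≤ D) (n : ℕ) :
    |accT D n / (D + 1)| ≤ 11 * ((n + 1 : ℝ) ^ 2 * (1/3) ^ n) := by
  unfold accT
  rw [mul_div_assoc, abs_mul]
  have hn : (0 : ℝ) ≤ n := by positivity
  have h2 : |(7 * (n:ℝ) ^ 2 + (6 + 5 * D) * n + 1 + 3 * D) / (D + 1)| ≤ 11 * ((n:ℝ) + 1) ^ 2 := by
    rw [abs_of_nonneg (by positivity), div_le_iff₀ (by positivity)]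
    nlinarith [mul_nonneg hn hD, mul_nonneg (mul_nonneg hn hn) hD]
  calc _ ≤ (1/3) ^ n * (11 * (n + 1 : ℝ) ^ 2) :=
        mul_le_mul (accAX_bound n (accR_bound hD n)) h2 (abs_nonneg _) (by positivity)
    _ = _ := by ring

lemma summable_bound : Summable fun n : ℕ => 11 * ((n + 1 : ℝ) ^ 2 * (1/3) ^ n) := by
  apply Summable.mul_left
  have h2 := summable_pow_mul_geometric_of_norm_lt_one 2 (r := (1/3 : ℝ)) (by norm_num)
  have h1 := summable_pow_mul_geometric_of_norm_lt_one 1 (r := (1/3 : ℝ)) (by norm_num)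
  have h0 := summable_pow_mul_geometric_of_norm_lt_one 0 (r := (1/3 : ℝ)) (by norm_num)
  refine ((h2.add (h1.mul_left 2)).add h0).congr fun n => ?_
  ring

lemma accT_summable {D : ℝ} (hD : 0 ≤ D) : Summable (accT D) := by
  have h : Summable fun n => accT D n / (D + 1) :=
    Summable.of_norm_bounded summable_bound fun n => by
      rw [Real.norm_eq_abs]; exact accT_bound hD n
  refine (h.mul_right (D + 1)).congr fun n => ?_
  field_simp

/-- Telescoping certificate. -/
noncomputable def accH (D : ℝ) (n : ℕ) : ℝ :=
  (-1) ^ n * accA n * accB D n * ((D + 1 + n) ^ 2 * (3 * (3 * n + 1) * (3 * n + 2)) * n / (4 * D))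

lemma accR_eq {D : ℝ} (hD : 0 < D) (n : ℕ) :
    (D + 1) ^ 2 * accR D n = accB D n * ((D - n) * (D + 1 + n) ^ 2 / D) := by
  have h1 : poch (1 - D) n * D = poch (-D) n * (D - n) := by
    induction n with
    | zero => simp [poch_zero']
    | succ n ih =>
      rw [poch_succ', poch_succ']; push_cast
      linear_combination (1 - D + n) * ih
  have h2 : poch (D + 1) n * (D + 1 + n) = (D + 1) * poch (D + 2) n := by
    clear h1
    induction n with
    | zero => simp [poch_zero']
    | succ n ih =>
      rw [poch_succ', poch_succ']; push_cast
      linear_combination (D + 2 + n) * ih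
  have p1 := poch_pos' (by linarith : 0 < D + 1) n
  have p2 := poch_pos' (by linarith : 0 < D + 2) n
  have hn : 0 < D + 1 + n := by positivity
  have h3 : poch (D + 1) n = (D + 1) * poch (D + 2) n / (D + 1 + n) := by
    rw [eq_div_iff hn.ne']; exact h2
  have h4 : poch (1 - D) n = poch (-D) n * (D - n) / D := by
    rw [eq_div_iff hD.ne']; exact h1
  unfold accR accB
  rw [h3, h4]
  field_simp

lemma accR_eq' {D : ℝ} (hD : 0 < D) (n : ℕ) :
    accR (D + 1) n = accB D n * ((2 * D + n) * (2 * D + n + 1) / (2 * D * (2 * D + 1))) := by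
  have h1 : poch (2 * (D + 1)) n * (2 * D * (2 * D + 1)) =
      poch (2 * D) n * ((2 * D + n) * (2 * D + n + 1)) := by
    induction n with
    | zero => simp [poch_zero']
    | succ n ih =>
      rw [poch_succ', poch_succ']; push_cast
      linear_combination (2 * D + 2 + n) * ih
  have p2 := poch_pos' (by linarith : 0 < D + 2) n
  have h4 : poch (2 * (D + 1)) n =
      poch (2 * D) n * ((2 * D + n) * (2 * D + n + 1)) / (2 * D * (2 * D + 1)) := by
    rw [eq_div_iff (by positivity)]; exact h1
  unfold accR accB
  rw [h4, show 1 - (D + 1) = -D by ring, show D + 1 + 1 = D + 2 by ring]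
  field_simp

lemma accB_succ {D : ℝ} (hD : 0 < D) (n : ℕ) :
    accB D (n + 1) * (D + 2 + n) ^ 2 = accB D n * ((n - D) * (2 * D + n)) := by
  have p2 := poch_pos' (by linarith : 0 < D + 2) n
  have hn : 0 < D + 2 + n := by positivity
  unfold accB
  rw [poch_succ', poch_succ', poch_succ']
  field_simp
  ring

lemma accH_step {D : ℝ} (hD : 0 < D) (n : ℕ) :
    (D + 1) ^ 2 * accT D n - (D + 1/2) ^ 2 * accT (D + 1) n = accH D (n + 1) - accH D n := by
  have e1 : (D + 1) ^ 2 * accT D n = (-1) ^ n * accA n * ((D + 1) ^ 2 * accR D n) *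
      (7 * n ^ 2 + (6 + 5 * D) * n + 1 + 3 * D) := by unfold accT; ring
  have e2 : accH D (n + 1) = - (-1) ^ n * (accA (n + 1) * (3 * (3 * n + 4) * (3 * n + 5))) *
      (accB D (n + 1) * (D + 2 + n) ^ 2) * ((n + 1) / (4 * D)) := by
    unfold accH; push_cast; rw [pow_succ]; ring
  rw [e1, e2, accR_eq hD, accA_succ, accB_succ hD]
  unfold accT accH
  rw [accR_eq' hD]
  have : 2 * D + 1 ≠ 0 := by positivity
  field_simp
  ring

lemma accH_sum {D : ℝ} (hD : 0 < D) (N : ℕ) :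
    ∑ n ∈ Finset.range N, ((D + 1) ^ 2 * accT D n - (D + 1/2) ^ 2 * accT (D + 1) n) = accH D N := by
  rw [Finset.sum_congr rfl fun n _ => accH_step hD n, Finset.sum_range_sub]
  simp [accH]

lemma accH_tendsto {D : ℝ} (hD : 0 < D) :
    Filter.Tendsto (accH D) Filter.atTop (nhds 0) := by
  have h5 := tendsto_pow_const_mul_const_pow_of_abs_lt_one 5 (r := (1/3 : ℝ)) (by norm_num [abs_lt])
  have h := h5.const_mul ((D + 2) ^ 2 * 60 / (4 * D))
  rw [mul_zero] at h
  refine squeeze_zero_norm (fun n => ?_) h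
  rw [Real.norm_eq_abs]
  unfold accH
  rw [abs_mul]
  have hn : (0 : ℝ) ≤ n := by positivity
  rcases Nat.eq_zero_or_pos n with rfl | hpos
  · simp
  have h1 : (1 : ℝ) ≤ n := by exact_mod_cast hpos
  have hq : |(D + 1 + n) ^ 2 * (3 * (3 * (n:ℝ) + 1) * (3 * n + 2)) * n / (4 * D)| ≤
      (D + 2) ^ 2 * 60 / (4 * D) * n ^ 5 := by
    rw [abs_of_nonneg (by positivity), div_mul_eq_mul_div]
    apply div_le_div_of_nonneg_right _ (by positivity)
    have a1 : (D + 1 + n) ^ 2 ≤ ((D + 2) * n) ^ 2 := by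
      apply pow_le_pow_left₀ (by positivity)
      nlinarith
    have a2 : (3 * (3 * (n:ℝ) + 1) * (3 * n + 2)) ≤ 60 * n ^ 2 := by nlinarith
    calc (D + 1 + n) ^ 2 * (3 * (3 * (n:ℝ) + 1) * (3 * n + 2)) * n
        ≤ ((D + 2) * n) ^ 2 * (60 * n ^ 2) * n := by gcongr
      _ = _ := by ring
  calc _ ≤ (1/3) ^ n * ((D + 2) ^ 2 * 60 / (4 * D) * n ^ 5) :=
        mul_le_mul (accAX_bound n (accB_bound hD.le n)) hq (abs_nonneg _) (by positivity)
    _ = _ := by ring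

lemma accT_rec {D : ℝ} (hD : 0 < D) :
    (D + 1) ^ 2 * ∑' n, accT D n = (D + 1/2) ^ 2 * ∑' n, accT (D + 1) n := by
  have s1 := (accT_summable hD.le).mul_left ((D + 1) ^ 2)
  have s2 := (accT_summable (by linarith : 0 ≤ D + 1)).mul_left ((D + 1/2) ^ 2)
  have h := (s1.sub s2).hasSum.tendsto_sum_nat
  have h' := tendsto_nhds_unique (h.congr fun N => accH_sum hD N) (accH_tendsto hD)
  rw [s1.tsum_sub s2, tsum_mul_left, tsum_mul_left] at h'
  linarith

lemma accT_iter {D : ℝ} (hD : 0 < D) (m : ℕ) :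
    ∑' n, accT D n = (poch (D + 1/2) m / poch (D + 1) m) ^ 2 * ∑' n, accT (D + m) n := by
  induction m with
  | zero => simp [poch_zero']
  | succ m ih =>
    have h := accT_rec (by positivity : 0 < D + m)
    have p1 := poch_pos' (by linarith : 0 < D + 1) m
    have hx : 0 < D + m + 1 := by positivity
    rw [ih, poch_succ', poch_succ', Nat.cast_succ, ← add_assoc]
    have h' : ∑' n, accT (D + m) n =
        (D + m + 1/2) ^ 2 * (∑' n, accT (D + m + 1) n) / (D + m + 1) ^ 2 := by
      rw [eq_div_iff (by positivity)]; linarith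
    rw [h', show D + 1 + (m:ℝ) = D + m + 1 by ring, show D + 1/2 + (m:ℝ) = D + m + 1/2 by ring]
    field_simp

noncomputable def accL : ℝ := ∑' n : ℕ, (-1) ^ n * accA n * (-2) ^ n * (5 * n + 3)

lemma lin_ratio (a b c : ℝ) :
    Filter.Tendsto (fun x : ℝ => (a * x + b) / (x + c)) Filter.atTop (nhds a) := by
  have h1 : Filter.Tendsto (fun x : ℝ => x + c) Filter.atTop Filter.atTop :=
    Filter.tendsto_atTop_add_const_right _ _ Filter.tendsto_id
  have h2 := (h1.inv_tendsto_atTop.const_mul (b - a * c)).const_add a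
  rw [mul_zero, add_zero] at h2
  refine h2.congr' ?_
  filter_upwards [Filter.eventually_gt_atTop (-c)] with x hx
  have : x + c ≠ 0 := by linarith
  simp only [Pi.inv_apply]
  field_simp
  ring

lemma accR_tendsto (n : ℕ) :
    Filter.Tendsto (fun x : ℝ => accR x n) Filter.atTop (nhds ((-2) ^ n)) := by
  induction n with
  | zero => simp [accR, poch_zero']
  | succ n ih =>
    have h := (ih.mul (lin_ratio (-1) (1 + n) (1 + n))).mul (lin_ratio 2 n (1 + n))
    rw [show (-2 : ℝ) ^ n * -1 * 2 = (-2) ^ (n + 1) by ring] at h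
    refine h.congr fun x => ?_
    unfold accR
    rw [poch_succ', poch_succ', poch_succ', mul_pow, div_mul_div_comm, div_mul_div_comm]
    congr 1 <;> ring

lemma accL_tendsto :
    Filter.Tendsto (fun x : ℝ => ∑' n, accT x n / (x + 1)) Filter.atTop (nhds accL) := by
  unfold accL
  refine tendsto_tsum_of_dominated_convergence summable_bound (fun n => ?_) ?_
  · have h := ((accR_tendsto n).const_mul ((-1) ^ n * accA n)).mul
      (lin_ratio (5 * n + 3) (7 * n ^ 2 + 6 * n + 1) 1)
    refine h.congr fun x => ?_
    unfold accT
    rw [mul_div_assoc]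
    congr 2; ring
  · filter_upwards [Filter.eventually_ge_atTop 0] with x hx n
    rw [Real.norm_eq_abs]; exact accT_bound hx n

lemma gamma_ratio {D : ℝ} (hD : 0 < D) :
    Filter.Tendsto (fun m : ℕ => (m : ℝ) * (poch (D + 1/2) (m + 1) / poch (D + 1) (m + 1)) ^ 2)
      Filter.atTop (nhds ((Real.Gamma (D + 1) / Real.Gamma (D + 1/2)) ^ 2)) := by
  have g1 := Real.GammaSeq_tendsto_Gamma (D + 1)
  have g2 := Real.GammaSeq_tendsto_Gamma (D + 1/2)
  have h := (g1.div g2 (Real.Gamma_pos_of_pos (by linarith)).ne').pow 2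
  refine h.congr' ?_
  filter_upwards [Filter.eventually_gt_atTop 0] with m hm
  have hm' : (0 : ℝ) < m := by exact_mod_cast hm
  have p1 := poch_pos' (by linarith : 0 < D + 1) (m + 1)
  have p2 := poch_pos' (by linarith : 0 < D + 1/2) (m + 1)
  simp only [Pi.div_apply, Real.GammaSeq]
  change ((m : ℝ) ^ (D + 1) * m.factorial / poch (D + 1) (m + 1) /
    ((m : ℝ) ^ (D + 1/2) * m.factorial / poch (D + 1/2) (m + 1))) ^ 2 = _
  have e : (m : ℝ) ^ (D + 1) = (m : ℝ) ^ (D + 1/2) * Real.sqrt m := by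
    rw [Real.sqrt_eq_rpow, ← Real.rpow_add hm']; congr 1; ring
  have hp : 0 < (m : ℝ) ^ (D + 1/2) := Real.rpow_pos_of_pos hm' _
  have hf : (0 : ℝ) < m.factorial := by positivity
  rw [e]
  have hs : Real.sqrt m ^ 2 = m := Real.sq_sqrt hm'.le
  rw [show (m : ℝ) ^ (D + 1/2) * Real.sqrt m * m.factorial / poch (D + 1) (m + 1) /
    ((m : ℝ) ^ (D + 1/2) * m.factorial / poch (D + 1/2) (m + 1)) =
    Real.sqrt m * (poch (D + 1/2) (m + 1) / poch (D + 1) (m + 1)) by field_simp]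
  rw [mul_pow, hs]

lemma accT_eval {D : ℝ} (hD : 0 < D) :
    ∑' n, accT D n = (Real.Gamma (D + 1) / Real.Gamma (D + 1/2)) ^ 2 * accL := by
  have hc : Filter.Tendsto (fun m : ℕ => D + ((m + 1 : ℕ) : ℝ)) Filter.atTop Filter.atTop :=
    Filter.tendsto_atTop_add_const_left _ _
      (tendsto_natCast_atTop_atTop.comp (Filter.tendsto_add_atTop_nat 1))
  have h1 := accL_tendsto.comp hc
  have h2 := ((lin_ratio 1 (D + 2) 0).comp (tendsto_natCast_atTop_atTop (R := ℝ)))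
  have h := ((gamma_ratio hD).mul h2).mul h1
  rw [mul_one] at h
  refine tendsto_nhds_unique (tendsto_const_nhds.congr' ?_) h
  filter_upwards [Filter.eventually_gt_atTop 0] with m hm
  have hm' : (0 : ℝ) < m := by exact_mod_cast hm
  have hx : 0 < D + ((m + 1 : ℕ) : ℝ) + 1 := by positivity
  simp only [Function.comp]
  rw [accT_iter hD (m + 1), tsum_div_const]
  have : D + ((m + 1 : ℕ) : ℝ) + 1 = 1 * m + (D + 2) := by push_cast; ring
  rw [this] at hx ⊢
  field_simp
  ring

lemma accL_eq : accL = π / 2 := by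
  have h := accT_eval one_pos
  have h1 : ∑' n, accT 1 n = 2 := by
    rw [tsum_eq_single 0]
    · simp [accT, accA, accR, poch_zero']; norm_num
    · intro n hn
      have : poch (1 - 1) n = 0 := by
        apply Finset.prod_eq_zero (i := 0) (by simpa using Nat.pos_of_ne_zero hn)
        simp
      unfold accT accR
      rw [this]; simp
  have g : Real.Gamma (1 + 1/2) = 1/2 * Real.sqrt π := by
    rw [add_comm, Real.Gamma_add_one (by norm_num), Real.Gamma_one_half_eq]
  rw [h1, g, one_add_one_eq_two, Real.Gamma_two] at h
  have hs : Real.sqrt π ^ 2 = π := Real.sq_sqrt Real.pi_pos.le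
  rw [div_pow, mul_pow, hs] at h
  have := Real.pi_pos
  field_simp at h
  linarith

lemma fact_poch (n : ℕ) : ((3 * n + 2).factorial : ℝ) =
    27 ^ n * poch 1 n * poch (4/3) n * poch (2/3) n * (3 * n + 2) := by
  induction n with
  | zero => simp [poch_zero']
  | succ n ih =>
    rw [fact_step, ih, poch_succ', poch_succ', poch_succ', pow_succ]
    push_cast; ring

lemma term_eq (n : ℕ) : (-1/27 : ℝ) ^ n *
      (poch 1 n * poch (1/2) n * poch (2/3) n / poch (4/3) n ^ 3) *
      (3 + 7 * n) = 3 * accT (1/3) n := by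
  have p1 := poch_pos' (by norm_num : (0:ℝ) < 1) n
  have p2 := poch_pos' (by norm_num : (0:ℝ) < 2/3) n
  have p4 := poch_pos' (by norm_num : (0:ℝ) < 4/3) n
  have hf : (n.factorial : ℝ) = poch 1 n := by
    clear p1 p2 p4
    induction n with
    | zero => simp [poch_zero']
    | succ n ih => rw [poch_succ', Nat.factorial_succ, ← ih]; push_cast; ring
  have h := fact_poch n
  unfold accT accA accR
  rw [h, hf, show (1 - 1/3 : ℝ) = 2/3 by norm_num, show (2 * (1/3) : ℝ) = 2/3 by norm_num,
    show (1/3 + 1 : ℝ) = 4/3 by norm_num, div_pow]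
  field_simp
  ring

theorem series_pi_gamma_third :
    π * Real.Gamma (1/3) ^ 2 / (6 * Real.Gamma (5/6) ^ 2) = ∑' n : ℕ, (-1/27 : ℝ) ^ n *
      (poch 1 n * poch (1/2) n * poch (2/3) n / poch (4/3) n ^ 3) *
      (3 + 7 * n) := by
  rw [tsum_congr term_eq, tsum_mul_left, accT_eval (by norm_num), accL_eq,
    Real.Gamma_add_one (by norm_num), show (1/3 + 1/2 : ℝ) = 5/6 by norm_num]
  have : Real.Gamma (5/6) ≠ 0 := (Real.Gamma_pos_of_pos (by norm_num)).ne'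
  field_simp
  ring
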